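/- arXiv:1507.04986 — 6 statements merged into one kernel-verified Lean document; each statement's English description precedes it below -/
import Mathlib

section
/- Let 0<s<1. There exists a constant C_s>0 (depending only on s) such that for every integer m≠0 one has K_s(m) ≤ C_s/|m|^{1+2s}, where K_s(m) = 4^s Γ(1/2+s) Γ(|m|−s) / (√π |Γ(−s)| Γ(|m|+1+s)). -/
open Real

/-- The kernel of the one-dimensional fractional discrete Laplacian:
`K_s(0) = 0` and, for `m ≠ 0`,
`K_s(m) = 4^s Γ(1/2+s) Γ(|m|−s) / (√π |Γ(−s)| Γ(|m|+1+s))`. -/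
noncomputable def Ks (s : ℝ) (m : ℤ) : ℝ :=
  if m = 0 then 0
  else 4 ^ s * Real.Gamma (1 / 2 + s) * Real.Gamma (|(m : ℝ)| - s) /
    (Real.sqrt Real.pi * |Real.Gamma (-s)| * Real.Gamma (|(m : ℝ)| + 1 + s))

/-- Gautschi's inequality. -/
theorem Gamma_add_one_sub_le {x s : ℝ} (hx : 0 < x) (hs0 : 0 < s) (hs1 : s < 1) :
    Real.Gamma (x + 1 - s) ≤ Real.Gamma (x + 1) * x ^ (-s) := by
  have hG := Real.Gamma_pos_of_pos hx
  have h := Real.Gamma_mul_add_mul_le_rpow_Gamma_mul_rpow_Gamma hx (by linarith : 0 < x + 1)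
    hs0 (sub_pos.2 hs1) (by ring)
  calc Real.Gamma (x + 1 - s) = Real.Gamma (s * x + (1 - s) * (x + 1)) := by ring_nf
    _ ≤ _ := h
    _ = Real.Gamma (x + 1) * x ^ (-s) := by
      rw [Real.Gamma_add_one hx.ne', mul_rpow hx.le hG.le, mul_left_comm, ← rpow_add hG,
        add_sub_cancel, rpow_one, sub_eq_add_neg, rpow_add hx, rpow_one]
      ring

theorem Gamma_add_one_sub_le_Gamma_add_one_add {x s : ℝ} (hx : 0 < x) (hs0 : 0 < s)
    (hs1 : s < 1) : Real.Gamma (x + 1 - s) ≤ Real.Gamma (x + 1 + s) * x ^ (-(2 * s)) := by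
  have hG : 0 < Real.Gamma (x + 1 + s) := Real.Gamma_pos_of_pos (by linarith)
  have h : Real.Gamma (x + 1) ≤ Real.Gamma (x + 1 + s) * (x + s) ^ (-s) := by
    convert Gamma_add_one_sub_le (by linarith : 0 < x + s) hs0 hs1 using 2 <;> ring_nf
  have hmono : (x + s) ^ (-s) ≤ x ^ (-s) :=
    rpow_le_rpow_of_nonpos hx (by linarith) (by linarith)
  calc Real.Gamma (x + 1 - s) ≤ Real.Gamma (x + 1) * x ^ (-s) := Gamma_add_one_sub_le hx hs0 hs1
    _ ≤ Real.Gamma (x + 1 + s) * x ^ (-s) * x ^ (-s) := by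
      gcongr
      exact h.trans (by gcongr)
    _ = Real.Gamma (x + 1 + s) * x ^ (-(2 * s)) := by
      rw [mul_assoc, ← rpow_add hx]
      ring_nf

theorem Gamma_sub_div_Gamma_add_one_add_le {x s : ℝ} (hx : 1 ≤ x) (hs0 : 0 < s) (hs1 : s < 1) :
    Real.Gamma (x - s) / Real.Gamma (x + 1 + s) ≤ (1 - s)⁻¹ / x ^ (1 + 2 * s) := by
  have hx0 : 0 < x := by linarith
  have hs : 0 < 1 - s := sub_pos.2 hs1
  have hG : 0 < Real.Gamma (x + 1 + s) := Real.Gamma_pos_of_pos (by linarith)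
  have hG' : 0 < Real.Gamma (x - s) := Real.Gamma_pos_of_pos (by linarith)
  have h := Gamma_add_one_sub_le_Gamma_add_one_add hx0 hs0 hs1
  rw [show x + 1 - s = x - s + 1 by ring, Real.Gamma_add_one (by linarith), rpow_neg hx0.le,
    ← div_eq_mul_inv, le_div_iff₀ (by positivity)] at h
  rw [div_le_div_iff₀ hG (by positivity), rpow_add hx0, rpow_one, inv_mul_eq_div,
    le_div_iff₀ hs]
  calc Real.Gamma (x - s) * (x * x ^ (2 * s)) * (1 - s)
      = x * (1 - s) * (Real.Gamma (x - s) * x ^ (2 * s)) := by ring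
    _ ≤ (x - s) * (Real.Gamma (x - s) * x ^ (2 * s)) := by
      gcongr
      nlinarith
    _ ≤ Real.Gamma (x + 1 + s) := by linarith

theorem kernel_upper_bound (s : ℝ) (hs0 : 0 < s) (hs1 : s < 1) :
    ∃ C : ℝ, 0 < C ∧ ∀ m : ℤ, m ≠ 0 → Ks s m ≤ C / |(m : ℝ)| ^ (1 + 2 * s) := by
  have hG : Real.Gamma (-s) ≠ 0 := Real.Gamma_ne_zero fun n hn => by
    obtain rfl | hn' := n.eq_zero_or_pos
    · simp at hn
      linarith
    · have : (1 : ℝ) ≤ n := by exact_mod_cast hn'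
      linarith
  have hG' : 0 < Real.Gamma (1 / 2 + s) := Real.Gamma_pos_of_pos (by linarith)
  have hs : 0 < 1 - s := sub_pos.2 hs1
  refine ⟨4 ^ s * Real.Gamma (1 / 2 + s) / (√π * |Real.Gamma (-s)|) * (1 - s)⁻¹,
    by positivity, fun m hm => ?_⟩
  have hm1 : (1 : ℝ) ≤ |(m : ℝ)| := by exact_mod_cast Int.one_le_abs hm
  rw [Ks, if_neg hm, mul_div_mul_comm, mul_div_assoc _ (1 - s)⁻¹]
  exact mul_le_mul_of_nonneg_left (Gamma_sub_div_Gamma_add_one_add_le hm1 hs0 hs1) (by positivity)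
end

section
/- Let h>0 and let u : ℤ → ℝ satisfy ∑_{m∈ℤ} |u_m|/(1+|m|) < ∞ (i.e. u ∈ ℓ_0). Then for every j ∈ ℤ, the limit as s→0⁺ of (−Δ_h)^s u_j := h^{−2s} ∑_{m≠j} (u_j − u_m) K_s(j−m) equals u_j. -/
open Real Filter

/-- The fractional discrete Laplacian on the mesh `hℤ`:
`(−Δ_h)^s u_j = h^{−2s} ∑_{m ≠ j} (u_j − u_m) K_s(j−m)`. -/
noncomputable def fracDiscLap (s h : ℝ) (u : ℤ → ℝ) (j : ℤ) : ℝ :=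
  h ^ (-(2 * s)) * ∑' m : ℤ, (u j - u m) * Ks s (j - m)

/-- The total mass of the kernel `Ks s` over `ℤ`. -/
noncomputable def KsMass (s : ℝ) : ℝ :=
  4 ^ s * Real.Gamma (1 / 2 + s) / (Real.sqrt Real.pi * Real.Gamma (1 + s))

/-- The ratio `Γ(n + 1 - s) / Γ(n + 1 + s)`, whose increments are multiples of the kernel. -/
noncomputable def gammaRatio (s : ℝ) (n : ℕ) : ℝ :=
  Real.Gamma (n + 1 - s) / Real.Gamma (n + 1 + s)

theorem gammaRatio_pos {s : ℝ} (hs : 0 < s) (hs1 : s < 1) (n : ℕ) : 0 < gammaRatio s n := by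
  have hn : (0 : ℝ) ≤ n := n.cast_nonneg
  exact div_pos (Real.Gamma_pos_of_pos (by linarith)) (Real.Gamma_pos_of_pos (by linarith))

theorem gammaRatio_sub_succ {s : ℝ} (hs : 0 < s) (hs1 : s < 1) (n : ℕ) :
    gammaRatio s n - gammaRatio s (n + 1) = gammaRatio s n * (2 * s / (n + 1 + s)) := by
  have hn : (0 : ℝ) ≤ n := n.cast_nonneg
  have hpos : 0 < Real.Gamma (n + 1 + s) := Real.Gamma_pos_of_pos (by linarith)
  have h1 : Real.Gamma ((n + 1 : ℕ) + 1 - s) = (n + 1 - s) * Real.Gamma (n + 1 - s) := by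
    rw [← Real.Gamma_add_one (by linarith)]
    push_cast
    ring_nf
  have h2 : Real.Gamma ((n + 1 : ℕ) + 1 + s) = (n + 1 + s) * Real.Gamma (n + 1 + s) := by
    rw [← Real.Gamma_add_one (by linarith)]
    push_cast
    ring_nf
  have h3 : (n : ℝ) + 1 + s ≠ 0 := by linarith
  unfold gammaRatio
  rw [h1, h2]
  field_simp
  ring

theorem gammaRatio_antitone {s : ℝ} (hs : 0 < s) (hs1 : s < 1) : Antitone (gammaRatio s) := by
  refine antitone_nat_of_succ_le fun n => ?_
  have h := gammaRatio_sub_succ hs hs1 n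
  have hpos := gammaRatio_pos hs hs1 n
  have : 0 ≤ gammaRatio s n * (2 * s / (n + 1 + s)) := by positivity
  linarith

theorem gammaRatio_le_rpow {s : ℝ} (hs : 0 < s) (hs2 : s < 1 / 2) (n : ℕ) :
    gammaRatio s n ≤ ((n : ℝ) + s) ^ (-(2 * s)) := by
  have hx : (0 : ℝ) < n + s := by positivity
  have hG : 0 < Real.Gamma (n + s) := Real.Gamma_pos_of_pos hx
  have hrec : Real.Gamma (n + 1 + s) = (n + s) * Real.Gamma (n + s) := by
    rw [← Real.Gamma_add_one hx.ne']
    ring_nf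
  have hconv := Real.Gamma_mul_add_mul_le_rpow_Gamma_mul_rpow_Gamma hx
    (show (0 : ℝ) < n + 1 + s by positivity) (show 0 < 2 * s by linarith)
    (show 0 < 1 - 2 * s by linarith) (by ring)
  rw [show 2 * s * (n + s) + (1 - 2 * s) * (n + 1 + s) = (n : ℝ) + 1 - s by ring, hrec] at hconv
  rw [gammaRatio, hrec, div_le_iff₀ (by positivity)]
  refine hconv.trans_eq ?_
  rw [Real.mul_rpow hx.le hG.le, mul_left_comm, ← Real.rpow_add hG, ← mul_assoc,
    Real.rpow_sub hx, Real.rpow_neg hx.le, Real.rpow_one]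
  simp only [add_sub_cancel, Real.rpow_one]
  ring

theorem tendsto_gammaRatio_atTop {s : ℝ} (hs : 0 < s) (hs2 : s < 1 / 2) :
    Tendsto (gammaRatio s) atTop (nhds 0) := by
  refine squeeze_zero (fun n => (gammaRatio_pos hs (by linarith) n).le)
    (gammaRatio_le_rpow hs hs2) ?_
  exact (tendsto_rpow_neg_atTop (show 0 < 2 * s by linarith)).comp
    (tendsto_atTop_add_const_right _ s tendsto_natCast_atTop_atTop)

theorem Ks_neg (s : ℝ) (m : ℤ) : Ks s (-m) = Ks s m := by
  simp [Ks]

theorem abs_Gamma_neg {s : ℝ} (hs : 0 < s) (hs1 : s < 1) :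
    |Real.Gamma (-s)| = Real.Gamma (1 - s) / s := by
  have h := Real.Gamma_add_one (neg_ne_zero.mpr hs.ne')
  have hpos : 0 < Real.Gamma (1 - s) := Real.Gamma_pos_of_pos (by linarith)
  rw [neg_add_eq_sub] at h
  rw [eq_div_iff hs.ne', ← abs_of_pos hpos, h, abs_mul, abs_neg, abs_of_pos hs, mul_comm]

theorem Ks_natCast_succ {s : ℝ} (hs : 0 < s) (hs1 : s < 1) (n : ℕ) :
    Ks s ((n : ℤ) + 1) = KsMass s * (s / (n + 1 + s)) * (gammaRatio s n / gammaRatio s 0) := by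
  have hn : (0 : ℝ) ≤ n := n.cast_nonneg
  have h0 : ((n : ℤ) + 1) ≠ 0 := by omega
  have habs : |(((n : ℤ) + 1 : ℤ) : ℝ)| = n + 1 := by
    push_cast
    exact abs_of_nonneg (by linarith)
  have hpos : 0 < Real.Gamma (n + 1 + s) := Real.Gamma_pos_of_pos (by linarith)
  have hpos1 : 0 < Real.Gamma (1 + s) := Real.Gamma_pos_of_pos (by linarith)
  have hpos2 : 0 < Real.Gamma (1 - s) := Real.Gamma_pos_of_pos (by linarith)
  have hrec : Real.Gamma (n + 1 + 1 + s) = (n + 1 + s) * Real.Gamma (n + 1 + s) := by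
    rw [← Real.Gamma_add_one (by linarith)]
    ring_nf
  have hpi : 0 < Real.sqrt Real.pi := Real.sqrt_pos.mpr Real.pi_pos
  have h3 : (n : ℝ) + 1 + s ≠ 0 := by linarith
  rw [Ks, if_neg h0, habs, abs_Gamma_neg hs hs1, hrec, KsMass, gammaRatio, gammaRatio]
  simp only [Nat.cast_zero, zero_add]
  field_simp

theorem KsMass_pos {s : ℝ} (hs : 0 < s) : 0 < KsMass s := by
  have hpos1 : 0 < Real.Gamma (1 + s) := Real.Gamma_pos_of_pos (by linarith)
  have hpos2 : 0 < Real.Gamma (1 / 2 + s) := Real.Gamma_pos_of_pos (by linarith)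
  have hpi : 0 < Real.sqrt Real.pi := Real.sqrt_pos.mpr Real.pi_pos
  unfold KsMass
  positivity

theorem Ks_natCast_succ_nonneg {s : ℝ} (hs : 0 < s) (hs1 : s < 1) (n : ℕ) :
    0 ≤ Ks s ((n : ℤ) + 1) := by
  have := KsMass_pos hs
  have := gammaRatio_pos hs hs1 n
  have := gammaRatio_pos hs hs1 0
  rw [Ks_natCast_succ hs hs1]
  positivity

theorem Ks_natCast_succ_le {s : ℝ} (hs : 0 < s) (hs1 : s < 1) (n : ℕ) :
    Ks s ((n : ℤ) + 1) ≤ s * KsMass s / (n + 1) := by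
  have hM := KsMass_pos hs
  have h0 := gammaRatio_pos hs hs1 0
  have hratio : gammaRatio s n / gammaRatio s 0 ≤ 1 :=
    (div_le_one h0).mpr (gammaRatio_antitone hs hs1 n.zero_le)
  rw [Ks_natCast_succ hs hs1]
  calc KsMass s * (s / (n + 1 + s)) * (gammaRatio s n / gammaRatio s 0)
      ≤ KsMass s * (s / (n + 1 + s)) * 1 := by gcongr
    _ ≤ KsMass s * (s / (n + 1)) * 1 := by
        gcongr KsMass s * (s / ?_) * 1
        linarith
    _ = s * KsMass s / (n + 1) := by ring

theorem exists_natCast_succ_eq_or_neg {m : ℤ} (hm : m ≠ 0) :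
    ∃ n : ℕ, m = (n : ℤ) + 1 ∨ m = -((n : ℤ) + 1) :=
  ⟨m.natAbs - 1, by omega⟩

theorem Ks_nonneg {s : ℝ} (hs : 0 < s) (hs1 : s < 1) (m : ℤ) : 0 ≤ Ks s m := by
  rcases eq_or_ne m 0 with rfl | hm
  · simp [Ks]
  · obtain ⟨n, rfl | rfl⟩ := exists_natCast_succ_eq_or_neg hm
    · exact Ks_natCast_succ_nonneg hs hs1 n
    · rw [Ks_neg]
      exact Ks_natCast_succ_nonneg hs hs1 n

theorem Ks_le {s : ℝ} (hs : 0 < s) (hs1 : s < 1) (m : ℤ) :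
    Ks s m ≤ s * KsMass s / |(m : ℝ)| := by
  rcases eq_or_ne m 0 with rfl | hm
  · simp [Ks]
  · obtain ⟨n, hn⟩ := exists_natCast_succ_eq_or_neg hm
    have hKs : Ks s m = Ks s ((n : ℤ) + 1) := by
      rcases hn with rfl | rfl
      · rfl
      · exact Ks_neg _ _
    have habs : |(m : ℝ)| = n + 1 := by
      have hn0 : (0 : ℝ) ≤ n + 1 := by positivity
      rcases hn with rfl | rfl <;> push_cast
      · exact abs_of_nonneg hn0
      · rw [abs_neg, abs_of_nonneg hn0]
    rw [hKs, habs]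
    exact Ks_natCast_succ_le hs hs1 n

theorem hasSum_Ks_natCast_succ {s : ℝ} (hs : 0 < s) (hs2 : s < 1 / 2) :
    HasSum (fun n : ℕ => Ks s ((n : ℤ) + 1)) (KsMass s / 2) := by
  have hs1 : s < 1 := by linarith
  have h0 := gammaRatio_pos hs hs1 0
  have hterm (n : ℕ) : Ks s ((n : ℤ) + 1) =
      KsMass s / (2 * gammaRatio s 0) * (gammaRatio s n - gammaRatio s (n + 1)) := by
    rw [Ks_natCast_succ hs hs1, gammaRatio_sub_succ hs hs1]
    field_simp
  rw [hasSum_iff_tendsto_nat_of_nonneg (Ks_natCast_succ_nonneg hs hs1)]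
  simp_rw [hterm, ← Finset.mul_sum, Finset.sum_range_sub']
  have h := ((tendsto_gammaRatio_atTop hs hs2).const_sub (gammaRatio s 0)).const_mul
    (KsMass s / (2 * gammaRatio s 0))
  convert h using 2
  field_simp
  ring

theorem hasSum_Ks {s : ℝ} (hs : 0 < s) (hs2 : s < 1 / 2) : HasSum (Ks s) (KsMass s) := by
  have h := hasSum_Ks_natCast_succ hs hs2
  have hnat : HasSum (fun n : ℕ => Ks s (n : ℤ)) (KsMass s / 2) := by
    rw [← hasSum_nat_add_iff' 1]
    simpa [Ks] using h
  have hneg : HasSum (fun n : ℕ => Ks s (-((n : ℤ) + 1))) (KsMass s / 2) := by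
    simpa only [Ks_neg] using h
  simpa using hnat.of_nat_of_neg_add_one hneg

theorem tendsto_KsMass_zero : Tendsto KsMass (nhds 0) (nhds 1) := by
  have hc : ContinuousAt KsMass 0 := by
    have hG {a : ℝ} (ha : 0 < a) : ContinuousAt (fun s => Real.Gamma (a + s)) 0 := by
      have hd : ContinuousAt Real.Gamma (a + 0) :=
        (Real.differentiableAt_Gamma fun m => by
          have : (0 : ℝ) ≤ m := m.cast_nonneg
          linarith).continuousAt
      exact ContinuousAt.comp (f := fun s => a + s) hd (by fun_prop)
    have hpow : ContinuousAt (fun s : ℝ => (4 : ℝ) ^ s) 0 :=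
      Real.continuousAt_const_rpow (by norm_num)
    refine (hpow.mul (hG (by norm_num))).div (continuousAt_const.mul (hG one_pos)) ?_
    have hpi : 0 < Real.sqrt Real.pi := Real.sqrt_pos.mpr Real.pi_pos
    simp [hpi.ne']
  have h1 : KsMass 0 = 1 := by
    have hpi : 0 < Real.sqrt Real.pi := Real.sqrt_pos.mpr Real.pi_pos
    rw [KsMass, add_zero, add_zero, Real.Gamma_one_half_eq, Real.Gamma_one, Real.rpow_zero]
    field_simp
  exact h1 ▸ hc.tendsto

theorem norm_mul_Ks_le {s : ℝ} (hs : 0 < s) (hs1 : s < 1) (u : ℤ → ℝ) (j m : ℤ) :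
    ‖u m * Ks s (j - m)‖ ≤
      s * KsMass s * (2 + |(j : ℝ)|) * (|u m| / (1 + |(m : ℝ)|)) := by
  have hM := KsMass_pos hs
  rcases eq_or_ne j m with rfl | hne
  · simp only [sub_self, Ks, if_true, mul_zero, norm_zero]
    positivity
  have hone : (1 : ℝ) ≤ |((j - m : ℤ) : ℝ)| := by
    exact_mod_cast Int.one_le_abs (sub_ne_zero.mpr hne)
  have htri : |(m : ℝ)| ≤ |(j : ℝ)| + |((j - m : ℤ) : ℝ)| := by
    push_cast
    have := abs_sub (j : ℝ) (j - m)
    simpa using this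
  have hcmp : 1 / |((j - m : ℤ) : ℝ)| ≤ (2 + |(j : ℝ)|) / (1 + |(m : ℝ)|) := by
    rw [div_le_div_iff₀ (by linarith) (by positivity)]
    nlinarith [abs_nonneg (j : ℝ)]
  rw [norm_mul, Real.norm_eq_abs, Real.norm_of_nonneg (Ks_nonneg hs hs1 _)]
  calc |u m| * Ks s (j - m) ≤ |u m| * (s * KsMass s * (1 / |((j - m : ℤ) : ℝ)|)) := by
        rw [mul_one_div]
        gcongr
        exact Ks_le hs hs1 _
    _ ≤ |u m| * (s * KsMass s * ((2 + |(j : ℝ)|) / (1 + |(m : ℝ)|))) := by gcongr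
    _ = _ := by ring

theorem fracDiscLap_eq {s : ℝ} (hs : 0 < s) (hs2 : s < 1 / 2) (h : ℝ) {u : ℤ → ℝ}
    (hu : Summable fun m : ℤ => |u m| / (1 + |(m : ℝ)|)) (j : ℤ) :
    fracDiscLap s h u j =
      h ^ (-(2 * s)) * (u j * KsMass s - ∑' m : ℤ, u m * Ks s (j - m)) := by
  have hsum : Summable fun m : ℤ => u m * Ks s (j - m) :=
    .of_norm_bounded (hu.mul_left _) (norm_mul_Ks_le hs (by linarith) u j)
  have hmass : HasSum (fun m : ℤ => u j * Ks s (j - m)) (u j * KsMass s) :=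
    ((Equiv.subLeft j).hasSum_iff.mpr (hasSum_Ks hs hs2)).mul_left (u j)
  rw [fracDiscLap, ← (hmass.sub hsum.hasSum).tsum_eq]
  simp_rw [sub_mul]

theorem fracDiscLap_tendsto_id_of_s_to_zero (h : ℝ) (hh : 0 < h) (u : ℤ → ℝ)
    (hu : Summable fun m : ℤ => |u m| / (1 + |(m : ℝ)|)) (j : ℤ) :
    Tendsto (fun s : ℝ => fracDiscLap s h u j) (nhdsWithin 0 (Set.Ioo 0 1)) (nhds (u j)) := by
  have hsmall : ∀ᶠ s : ℝ in nhdsWithin 0 (Set.Ioo 0 1), 0 < s ∧ s < 1 / 2 := by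
    filter_upwards [self_mem_nhdsWithin,
      mem_nhdsWithin_of_mem_nhds (Iio_mem_nhds (show (0 : ℝ) < 1 / 2 by norm_num))] with s h1 h2
    exact ⟨h1.1, h2⟩
  have hid : Tendsto (fun s : ℝ => s) (nhdsWithin 0 (Set.Ioo 0 1)) (nhds 0) :=
    tendsto_id.mono_left nhdsWithin_le_nhds
  have hmass : Tendsto KsMass (nhdsWithin 0 (Set.Ioo 0 1)) (nhds 1) :=
    tendsto_KsMass_zero.mono_left nhdsWithin_le_nhds
  have htail : Tendsto (fun s => ∑' m : ℤ, u m * Ks s (j - m))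
      (nhdsWithin 0 (Set.Ioo 0 1)) (nhds 0) := by
    refine squeeze_zero_norm' (a := fun s => s * KsMass s * (2 + |(j : ℝ)|) *
      ∑' m : ℤ, |u m| / (1 + |(m : ℝ)|)) ?_ ?_
    · filter_upwards [hsmall] with s hs
      exact tsum_of_norm_bounded (hu.hasSum.mul_left _)
        (norm_mul_Ks_le hs.1 (by linarith [hs.2]) u j)
    · simpa using ((hid.mul hmass).mul_const (2 + |(j : ℝ)|)).mul_const
        (∑' m : ℤ, |u m| / (1 + |(m : ℝ)|))
  have hpow : Tendsto (fun s : ℝ => h ^ (-(2 * s))) (nhdsWithin 0 (Set.Ioo 0 1)) (nhds 1) := by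
    have hc : Continuous fun s : ℝ => h ^ (-(2 * s)) :=
      (Real.continuous_const_rpow hh.ne').comp (by fun_prop)
    simpa using (hc.tendsto 0).mono_left nhdsWithin_le_nhds
  have hlim := hpow.mul ((hmass.const_mul (u j)).sub htail)
  rw [mul_one, sub_zero, one_mul] at hlim
  refine hlim.congr' ?_
  filter_upwards [hsmall] with s hs
  exact (fracDiscLap_eq hs.1 hs.2 h hu j).symm
end

section
/- Let 0<s<1. Then ∑_{m∈ℤ, m≠0} K_s(m) = 2^{2s} Γ(1/2+s) / (√π Γ(1+s)); equivalently, 2 ∑_{m=1}^{∞} 4^s Γ(1/2+s) Γ(m−s) / (√π |Γ(−s)| Γ(m+1+s)) = 2^{2s} Γ(1/2+s) / (√π Γ(1+s)). -/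
open Real

/-- Iterating the functional equation of the Gamma function. -/
theorem Gamma_add_natCast_eq_mul_prod (s : ℝ) (n : ℕ) (hs : ∀ j : ℕ, s + j ≠ 0) :
    Real.Gamma (s + n) = Real.Gamma s * ∏ j ∈ Finset.range n, (s + j) := by
  induction n with
  | zero => simp
  | succ n ih =>
    rw [Finset.prod_range_succ, Nat.cast_succ, ← add_assoc, Real.Gamma_add_one (hs n), ih]
    ring

theorem tendsto_Gamma_ratio {s : ℝ} (hs0 : 0 < s) (hs1 : s < 1) :
    Filter.Tendsto (fun n : ℕ => Real.Gamma (n + 1 - s) / Real.Gamma (n + 1 + s))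
      Filter.atTop (nhds 0) := by
  have hneg : ∀ j : ℕ, -s + j ≠ 0 := by
    intro j
    rcases j with _ | j
    · simpa using hs0.ne'
    · push_cast
      have : (0 : ℝ) ≤ j := j.cast_nonneg
      linarith
  have hpos : ∀ j : ℕ, s + j ≠ 0 := fun j => by positivity
  have hG : Real.Gamma (-s) ≠ 0 := Real.Gamma_ne_zero fun m h => hneg m (by linarith)
  have hG' : Real.Gamma s ≠ 0 := (Real.Gamma_pos_of_pos hs0).ne'
  have hpow : Filter.Tendsto (fun n : ℕ => (n : ℝ) ^ (-(2 * s))) Filter.atTop (nhds 0) :=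
    (tendsto_rpow_neg_atTop (by positivity)).comp tendsto_natCast_atTop_atTop
  have key := ((((Real.GammaSeq_tendsto_Gamma s).div
    (Real.GammaSeq_tendsto_Gamma (-s)) hG).mul hpow).const_mul
      (Real.Gamma (-s) / Real.Gamma s))
  rw [mul_zero, mul_zero] at key
  refine key.congr' ?_
  filter_upwards [Filter.eventually_gt_atTop 0] with n hn
  have hn' : (0 : ℝ) < n := by exact_mod_cast hn
  have e1 := Gamma_add_natCast_eq_mul_prod s (n + 1) hpos
  have e2 := Gamma_add_natCast_eq_mul_prod (-s) (n + 1) hneg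
  have p1 : ∏ j ∈ Finset.range (n + 1), (s + j) ≠ 0 := Finset.prod_ne_zero_iff.2 fun j _ => hpos j
  have p2 : ∏ j ∈ Finset.range (n + 1), (-s + j) ≠ 0 :=
    Finset.prod_ne_zero_iff.2 fun j _ => hneg j
  have a1 : (n : ℝ) + 1 + s = s + (n + 1 : ℕ) := by push_cast; ring
  have a2 : (n : ℝ) + 1 - s = -s + (n + 1 : ℕ) := by push_cast; ring
  have hf : (n.factorial : ℝ) ≠ 0 := by exact_mod_cast n.factorial_ne_zero
  have hr : (n : ℝ) ^ (-(2 * s)) = (n : ℝ) ^ (-s) / (n : ℝ) ^ s := by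
    rw [← Real.rpow_sub hn']; ring_nf
  have r1 : (n : ℝ) ^ s ≠ 0 := (Real.rpow_pos_of_pos hn' _).ne'
  have r2 : (n : ℝ) ^ (-s) ≠ 0 := (Real.rpow_pos_of_pos hn' _).ne'
  rw [a1, a2, e1, e2, hr]
  simp only [Pi.div_apply, Real.GammaSeq]
  field_simp

theorem hasSum_Gamma_ratio {s : ℝ} (hs0 : 0 < s) (hs1 : s < 1) :
    HasSum (fun n : ℕ => Real.Gamma (n + 1 - s) / Real.Gamma (n + 1 + 1 + s))
      (Real.Gamma (1 - s) / Real.Gamma (1 + s) / (2 * s)) := by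
  have hnum (n : ℕ) : 0 < (n : ℝ) + 1 - s := by
    have : (0 : ℝ) ≤ n := n.cast_nonneg
    linarith
  rw [hasSum_iff_tendsto_nat_of_nonneg fun n =>
    (div_pos (Real.Gamma_pos_of_pos (hnum n)) (Real.Gamma_pos_of_pos (by positivity))).le]
  have hterm (n : ℕ) : Real.Gamma (n + 1 - s) / Real.Gamma (n + 1 + 1 + s) =
      (Real.Gamma (n + 1 - s) / Real.Gamma (n + 1 + s) -
        Real.Gamma ((n + 1 : ℕ) + 1 - s) / Real.Gamma ((n + 1 : ℕ) + 1 + s)) / (2 * s) := by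
    have hden : (0 : ℝ) < n + 1 + s := by positivity
    have hG := (Real.Gamma_pos_of_pos hden).ne'
    have e1 : (n : ℝ) + 1 + 1 + s = n + 1 + s + 1 := by ring
    have e2 : (n : ℝ) + 1 + 1 - s = n + 1 - s + 1 := by ring
    push_cast
    rw [e1, e2, Real.Gamma_add_one hden.ne', Real.Gamma_add_one (hnum n).ne']
    field_simp
    ring
  simp_rw [hterm, ← Finset.sum_div, Finset.sum_range_sub']
  simpa using ((tendsto_Gamma_ratio hs0 hs1).const_sub
    (Real.Gamma (1 - s) / Real.Gamma (1 + s))).div_const (2 * s)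

theorem hasSum_Ks_s3 {s : ℝ} (hs0 : 0 < s) (hs1 : s < 1) :
    HasSum (Ks s)
      (2 ^ (2 * s) * Real.Gamma (1 / 2 + s) / (Real.sqrt Real.pi * Real.Gamma (1 + s))) := by
  set C := 4 ^ s * Real.Gamma (1 / 2 + s) / (Real.sqrt Real.pi * |Real.Gamma (-s)|) with hC
  have h := (hasSum_Gamma_ratio hs0 hs1).mul_left C
  have habs (n : ℕ) : |(n : ℝ) + 1| = n + 1 := abs_of_pos (by positivity)
  have hKpos (n : ℕ) : Ks s (n + 1) =
      C * (Real.Gamma (n + 1 - s) / Real.Gamma (n + 1 + 1 + s)) := by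
    rw [Ks, if_neg (by omega), hC]
    push_cast
    rw [habs, div_mul_div_comm]
  have hKneg (n : ℕ) : Ks s (-(n + 1)) = Ks s (n + 1) := by
    simp only [Ks, Int.cast_neg, abs_neg, neg_eq_zero]
  have hsum := HasSum.of_add_one_of_neg_add_one (f := Ks s)
    (by simpa only [hKpos] using h) (by simpa only [hKneg, hKpos] using h)
  convert hsum using 1
  have hG : 0 < Real.Gamma (1 - s) := Real.Gamma_pos_of_pos (by linarith)
  have hG1 : 0 < Real.Gamma (1 + s) := Real.Gamma_pos_of_pos (by linarith)
  have hrec : Real.Gamma (1 - s) = -s * Real.Gamma (-s) := by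
    rw [← Real.Gamma_add_one (by linarith)]; ring_nf
  have hlt : Real.Gamma (-s) < 0 := by nlinarith
  have h4 : (4 : ℝ) ^ s = 2 ^ (2 * s) := by
    rw [Real.rpow_mul (by norm_num)]; norm_num
  have hK0 : Ks s 0 = 0 := if_pos rfl
  have hne := hlt.ne
  rw [hC, hK0, abs_of_neg hlt, hrec, h4]
  field_simp
  ring

theorem sum_kernel (s : ℝ) (hs0 : 0 < s) (hs1 : s < 1) :
    ∑' m : {m : ℤ // m ≠ 0}, Ks s (m : ℤ) =
      2 ^ (2 * s) * Real.Gamma (1 / 2 + s) / (Real.sqrt Real.pi * Real.Gamma (1 + s)) := by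
  rw [← (hasSum_Ks_s3 hs0 hs1).tsum_eq]
  refine tsum_subtype_eq_of_support_subset (s := {m : ℤ | m ≠ 0}) fun m hm h0 => hm ?_
  exact if_pos h0
end

section
/- Let 0<β≤1 and 0<s<1 with 2s<β. There exists a constant C>0 depending only on s and β such that for every h>0 and every bounded function u : ℤ → ℝ with finite discrete Hölder seminorm [u]_{C_h^{0,β}}, one has sup_j |(−Δ_h)^s u_j| + [(−Δ_h)^s u]_{C_h^{0,β−2s}} ≤ C (sup_j |u_j| + [u]_{C_h^{0,β}}). -/
open Real

/-- Forward difference `D_+ u_j = (u_{j+1} − u_j)/h`. -/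
noncomputable def Dp (h : ℝ) (u : ℤ → ℝ) (j : ℤ) : ℝ := (u (j + 1) - u j) / h

/-- Backward difference `D_− u_j = (u_j − u_{j−1})/h`. -/
noncomputable def Dm (h : ℝ) (u : ℤ → ℝ) (j : ℤ) : ℝ := (u j - u (j - 1)) / h

theorem sub_one_rpow_le {x a : ℝ} (hx : 1 ≤ x) (ha0 : 0 ≤ a) (ha1 : a ≤ 1) :
    (x - 1) ^ a ≤ x ^ a * (1 - a / x) := by
  have hx0 : 0 < x := by linarith
  have hb : -1 ≤ -(1 / x) := by
    rw [neg_le_neg_iff, div_le_one hx0]; exact hx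
  have key := rpow_one_add_le_one_add_mul_self hb ha0 ha1
  have e : x - 1 = x * (1 + -(1 / x)) := by field_simp; ring
  rw [e, Real.mul_rpow hx0.le (by linarith)]
  refine mul_le_mul_of_nonneg_left (key.trans (le_of_eq (by ring))) (Real.rpow_nonneg hx0.le a)

theorem rpow_sub_one_le_sub {x a : ℝ} (hx : 1 ≤ x) (ha0 : 0 < a) (ha1 : a ≤ 1) :
    x ^ (a - 1) ≤ (x ^ a - (x - 1) ^ a) / a := by
  have hx0 : 0 < x := by linarith
  have h := sub_one_rpow_le hx ha0.le ha1
  rw [le_div_iff₀ ha0, Real.rpow_sub_one hx0.ne']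
  have : x ^ a * (1 - a / x) = x ^ a - x ^ a / x * a := by ring
  linarith

theorem rpow_neg_one_sub_le_sub {x σ : ℝ} (hx : 1 ≤ x) (hσ0 : 0 < σ) (hσ1 : σ ≤ 1) :
    x ^ (-1 - σ) ≤ 2 ^ (1 + σ) / σ * (x ^ (-σ) - (x + 1) ^ (-σ)) := by
  have hx0 : 0 < x := by linarith
  have hy0 : 0 < x + 1 := by linarith
  have h := sub_one_rpow_le (x := x + 1) (by linarith) hσ0.le hσ1
  rw [add_sub_cancel_right] at h
  have hp := Real.rpow_pos_of_pos hx0 σ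
  have hq := Real.rpow_pos_of_pos hy0 σ
  have hdiff : σ * (x + 1) ^ (-1 - σ) ≤ x ^ (-σ) - (x + 1) ^ (-σ) := by
    rw [show -1 - σ = -σ - 1 by ring, Real.rpow_sub_one hy0.ne', Real.rpow_neg hy0.le,
      Real.rpow_neg hx0.le]
    have ht0 : 0 ≤ σ / (x + 1) := by positivity
    have h1 : ((x + 1) ^ σ)⁻¹ * (1 + σ / (x + 1)) ≤ (x ^ σ)⁻¹ := by
      rw [inv_mul_eq_div, div_le_iff₀ hq, inv_mul_eq_div, le_div_iff₀ hp]
      calc (1 + σ / (x + 1)) * x ^ σ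
          ≤ (1 + σ / (x + 1)) * ((x + 1) ^ σ * (1 - σ / (x + 1))) := by gcongr
        _ = (x + 1) ^ σ * (1 - (σ / (x + 1)) ^ 2) := by ring
        _ ≤ (x + 1) ^ σ * 1 := by
          gcongr
          nlinarith [sq_nonneg (σ / (x + 1))]
        _ = (x + 1) ^ σ := mul_one _
    have e : ((x + 1) ^ σ)⁻¹ * (1 + σ / (x + 1))
        = ((x + 1) ^ σ)⁻¹ + σ * (((x + 1) ^ σ)⁻¹ / (x + 1)) := by ring
    linarith
  have hdouble : x ^ (-1 - σ) ≤ 2 ^ (1 + σ) * (x + 1) ^ (-1 - σ) := by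
    have h2 : (2 * x) ^ (-1 - σ) ≤ (x + 1) ^ (-1 - σ) :=
      Real.rpow_le_rpow_of_nonpos hy0 (by linarith) (by linarith)
    rw [Real.mul_rpow zero_le_two hx0.le] at h2
    calc x ^ (-1 - σ) = 2 ^ (1 + σ) * (2 ^ (-1 - σ) * x ^ (-1 - σ)) := by
          rw [← mul_assoc, ← Real.rpow_add two_pos]
          simp
      _ ≤ _ := by gcongr
  calc x ^ (-1 - σ) ≤ 2 ^ (1 + σ) * (x + 1) ^ (-1 - σ) := hdouble
    _ = 2 ^ (1 + σ) / σ * (σ * (x + 1) ^ (-1 - σ)) := by field_simp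
    _ ≤ _ := by gcongr

/-- The truncated power weight, summable with sum of order `R ^ (-σ)`. -/
noncomputable def truncWeight (β σ R : ℝ) (n : ℕ) : ℝ :=
  min ((n / R : ℝ) ^ β) 1 * (n : ℝ) ^ (-1 - σ)

theorem truncWeight_nonneg {β σ R : ℝ} (hR : 0 < R) (n : ℕ) : 0 ≤ truncWeight β σ R n := by
  unfold truncWeight
  positivity

theorem truncWeight_zero {β σ R : ℝ} (hβ : 0 < β) : truncWeight β σ R 0 = 0 := by
  simp [truncWeight, Real.zero_rpow hβ.ne']

theorem sum_truncWeight_bounds {β σ R : ℝ} (hβ1 : β ≤ 1) (hσ0 : 0 < σ) (hσβ : σ < β)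
    (hR : 0 < R) (N : ℕ) :
    ((N : ℝ) ≤ R → ∑ i ∈ Finset.range (N + 1), truncWeight β σ R i
        ≤ R ^ (-β) * ((N : ℝ) ^ (β - σ) / (β - σ))) ∧
    (R < N → ∑ i ∈ Finset.range (N + 1), truncWeight β σ R i
        ≤ R ^ (-σ) / (β - σ) + 2 ^ (1 + σ) / σ * (R ^ (-σ) - ((N : ℝ) + 1) ^ (-σ))) := by
  have hβ0 : 0 < β := by linarith
  have ha0 : 0 < β - σ := by linarith
  induction N with
  | zero =>
    refine ⟨fun _ => ?_, fun h => ?_⟩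
    · simp [truncWeight_zero hβ0, Real.zero_rpow ha0.ne']
    · simp only [Nat.cast_zero] at h
      linarith
  | succ N ih =>
    have hN : (0 : ℝ) ≤ N := N.cast_nonneg
    have hN0 : (0 : ℝ) < (N : ℝ) + 1 := by positivity
    rw [Finset.sum_range_succ]
    push_cast
    refine ⟨fun h => ?_, fun h => ?_⟩
    · have h1 := ih.1 (by linarith)
      have h2 : truncWeight β σ R (N + 1) ≤ R ^ (-β) * ((N : ℝ) + 1) ^ (β - σ - 1) := by
        unfold truncWeight
        push_cast
        calc min ((((N : ℝ) + 1) / R) ^ β) 1 * ((N : ℝ) + 1) ^ (-1 - σ)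
            ≤ (((N : ℝ) + 1) / R) ^ β * ((N : ℝ) + 1) ^ (-1 - σ) := by
              gcongr
              exact min_le_left _ _
          _ = R ^ (-β) * (((N : ℝ) + 1) ^ β * ((N : ℝ) + 1) ^ (-1 - σ)) := by
              rw [Real.div_rpow hN0.le hR.le, Real.rpow_neg hR.le]
              ring
          _ = _ := by
              rw [← Real.rpow_add hN0]
              ring_nf
      have h3 := rpow_sub_one_le_sub (x := (N : ℝ) + 1) (by linarith) ha0 (by linarith)
      rw [add_sub_cancel_right, sub_div] at h3
      have h4 := mul_le_mul_of_nonneg_left h3 (Real.rpow_nonneg hR.le (-β))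
      rw [mul_sub] at h4
      linarith
    · have h2 : truncWeight β σ R (N + 1) ≤ ((N : ℝ) + 1) ^ (-1 - σ) := by
        unfold truncWeight
        push_cast
        exact mul_le_of_le_one_left (by positivity) (min_le_right _ _)
      have h3 := rpow_neg_one_sub_le_sub (x := (N : ℝ) + 1) (by linarith) hσ0 (by linarith)
      rcases le_or_gt (N : ℝ) R with hNR | hNR
      · have h1 := ih.1 hNR
        have h5 : R ^ (-β) * ((N : ℝ) ^ (β - σ) / (β - σ)) ≤ R ^ (-σ) / (β - σ) := by
          calc R ^ (-β) * ((N : ℝ) ^ (β - σ) / (β - σ))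
              ≤ R ^ (-β) * (R ^ (β - σ) / (β - σ)) := by gcongr
            _ = R ^ (-σ) / (β - σ) := by
              rw [← mul_div_assoc, ← Real.rpow_add hR]
              ring_nf
        have h6 : ((N : ℝ) + 1) ^ (-σ) ≤ R ^ (-σ) :=
          Real.rpow_le_rpow_of_nonpos hR h.le (by linarith)
        have h7 : 2 ^ (1 + σ) / σ * (((N : ℝ) + 1) ^ (-σ) - ((N : ℝ) + 1 + 1) ^ (-σ)) ≤
            2 ^ (1 + σ) / σ * (R ^ (-σ) - ((N : ℝ) + 1 + 1) ^ (-σ)) := by gcongr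
        linarith
      · have h1 := ih.2 hNR
        rw [mul_sub] at h1 h3 ⊢
        linarith

theorem sum_truncWeight_le {β σ R : ℝ} (hβ1 : β ≤ 1) (hσ0 : 0 < σ) (hσβ : σ < β)
    (hR : 0 < R) (n : ℕ) :
    ∑ i ∈ Finset.range n, truncWeight β σ R i
      ≤ (1 / (β - σ) + 2 ^ (1 + σ) / σ) * R ^ (-σ) := by
  have ha0 : 0 < β - σ := by linarith
  have hmono : ∑ i ∈ Finset.range n, truncWeight β σ R i
      ≤ ∑ i ∈ Finset.range (n + 1), truncWeight β σ R i := by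
    rw [Finset.sum_range_succ]
    linarith [truncWeight_nonneg (β := β) (σ := σ) hR n]
  have hR' := Real.rpow_pos_of_pos hR (-σ)
  have hc : 0 < (2 : ℝ) ^ (1 + σ) / σ := by positivity
  obtain ⟨h1, h2⟩ := sum_truncWeight_bounds hβ1 hσ0 hσβ hR n
  refine hmono.trans ?_
  rw [add_mul, one_div, inv_mul_eq_div]
  rcases le_or_gt (n : ℝ) R with hn | hn
  · refine (h1 hn).trans ?_
    calc R ^ (-β) * ((n : ℝ) ^ (β - σ) / (β - σ))
        ≤ R ^ (-β) * (R ^ (β - σ) / (β - σ)) := by gcongr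
      _ = R ^ (-σ) / (β - σ) := by
        rw [← mul_div_assoc, ← Real.rpow_add hR]
        ring_nf
      _ ≤ _ := by linarith [mul_pos hc hR']
  · refine (h2 hn).trans ?_
    gcongr
    linarith [Real.rpow_nonneg (show (0 : ℝ) ≤ n + 1 by positivity) (-σ)]

theorem Gamma_ratio_le {s : ℝ} (hs0 : 0 < s) (hs1 : s < 1) (n : ℕ) :
    Real.Gamma ((n : ℝ) + 1 - s) / Real.Gamma ((n : ℝ) + 1 + 1 + s) * ((n : ℝ) + 1 + s) ^ (1 + 2 * s)
      ≤ Real.Gamma (1 - s) / Real.Gamma (2 + s) * (1 + s) ^ (1 + 2 * s) := by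
  induction n with
  | zero =>
    norm_num
  | succ n ih =>
    refine le_trans ?_ ih
    have hn : (0 : ℝ) ≤ n := n.cast_nonneg
    push_cast
    have hA : 0 < (n : ℝ) + 1 - s := by linarith
    have hB : 0 < (n : ℝ) + 1 + 1 + s := by linarith
    have hGA := Real.Gamma_pos_of_pos hA
    have hGB := Real.Gamma_pos_of_pos hB
    rw [show (n : ℝ) + 1 + 1 - s = ((n : ℝ) + 1 - s) + 1 by ring, Real.Gamma_add_one hA.ne',
      show (n : ℝ) + 1 + 1 + 1 + s = ((n : ℝ) + 1 + 1 + s) + 1 by ring,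
      Real.Gamma_add_one hB.ne']
    have hb := one_add_mul_self_le_rpow_one_add (s := -(1 / ((n : ℝ) + 1 + 1 + s)))
      (by rw [neg_le_neg_iff, div_le_one hB]; linarith) (p := 1 + 2 * s) (by linarith)
    have e1 : 1 + (1 + 2 * s) * -(1 / ((n : ℝ) + 1 + 1 + s))
        = ((n : ℝ) + 1 - s) / ((n : ℝ) + 1 + 1 + s) := by
      field_simp
      ring
    have e2 : 1 + -(1 / ((n : ℝ) + 1 + 1 + s)) = ((n : ℝ) + 1 + s) / ((n : ℝ) + 1 + 1 + s) := by
      field_simp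
      ring
    rw [e1, e2, Real.div_rpow (by linarith) hB.le, le_div_iff₀ (by positivity)] at hb
    calc _ = Real.Gamma ((n : ℝ) + 1 - s) / Real.Gamma ((n : ℝ) + 1 + 1 + s) *
          (((n : ℝ) + 1 - s) / ((n : ℝ) + 1 + 1 + s) * ((n : ℝ) + 1 + 1 + s) ^ (1 + 2 * s)) := by
          field_simp
      _ ≤ _ := by gcongr

theorem exists_abs_Ks_le {s : ℝ} (hs0 : 0 < s) (hs1 : s < 1) :
    ∃ A : ℝ, 0 < A ∧ ∀ k : ℤ, |Ks s k| ≤ A * (k.natAbs : ℝ) ^ (-1 - 2 * s) := by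
  have hG1 : 0 < Real.Gamma (1 / 2 + s) := Real.Gamma_pos_of_pos (by linarith)
  have hG2 : 0 < Real.Gamma (1 - s) := Real.Gamma_pos_of_pos (by linarith)
  have hG3 : 0 < Real.Gamma (2 + s) := Real.Gamma_pos_of_pos (by linarith)
  set D : ℝ := Real.Gamma (1 - s) / Real.Gamma (2 + s) * (1 + s) ^ (1 + 2 * s) with hD
  have hD0 : 0 < D := by positivity
  set B : ℝ := 4 ^ s * Real.Gamma (1 / 2 + s) / (Real.sqrt Real.pi * |Real.Gamma (-s)|) with hB
  have hB0 : 0 ≤ B := by positivity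
  refine ⟨B * D + 1, by positivity, fun k => ?_⟩
  by_cases hk : k = 0
  · simp only [Ks, hk, if_true, abs_zero]
    positivity
  obtain ⟨n, hn⟩ : ∃ n : ℕ, k.natAbs = n + 1 :=
    Nat.exists_eq_succ_of_ne_zero (Int.natAbs_ne_zero.2 hk)
  have hkn : |(k : ℝ)| = (n : ℝ) + 1 := by
    rw [← Int.cast_abs, Int.abs_eq_natAbs, hn]
    push_cast
    ring
  have hn0 : (0 : ℝ) ≤ n := n.cast_nonneg
  have hN : (0 : ℝ) < (n : ℝ) + 1 := by positivity
  have hGA := Real.Gamma_pos_of_pos (show 0 < (n : ℝ) + 1 - s by linarith)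
  have hGB := Real.Gamma_pos_of_pos (show 0 < (n : ℝ) + 1 + 1 + s by linarith)
  have hr := Gamma_ratio_le hs0 hs1 n
  have hK : Ks s k = B * (Real.Gamma ((n : ℝ) + 1 - s) / Real.Gamma ((n : ℝ) + 1 + 1 + s)) := by
    rw [Ks, if_neg hk, hkn, hB, div_mul_div_comm]
  have hr' : Real.Gamma ((n : ℝ) + 1 - s) / Real.Gamma ((n : ℝ) + 1 + 1 + s)
      ≤ D * ((n : ℝ) + 1) ^ (-1 - 2 * s) := by
    rw [show -1 - 2 * s = -(1 + 2 * s) by ring, Real.rpow_neg hN.le, ← div_eq_mul_inv,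
      le_div_iff₀ (by positivity)]
    exact (mul_le_mul_of_nonneg_left
      (Real.rpow_le_rpow hN.le (by linarith) (by linarith)) (by positivity)).trans hr
  have hnn : 0 ≤ Real.Gamma ((n : ℝ) + 1 - s) / Real.Gamma ((n : ℝ) + 1 + 1 + s) := by positivity
  rw [hK, abs_of_nonneg (mul_nonneg hB0 hnn), hn]
  push_cast
  have hpw : 0 ≤ ((n : ℝ) + 1) ^ (-1 - 2 * s) := by positivity
  calc B * (Real.Gamma ((n : ℝ) + 1 - s) / Real.Gamma ((n : ℝ) + 1 + 1 + s))
      ≤ B * (D * ((n : ℝ) + 1) ^ (-1 - 2 * s)) := by gcongr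
    _ ≤ _ := by linarith

theorem exists_tsum_mul_Ks_le {β s : ℝ} (hβ1 : β ≤ 1) (hs0 : 0 < s) (hs1 : s < 1)
    (hsβ : 2 * s < β) :
    ∃ C : ℝ, 0 < C ∧ ∀ (R : ℝ), 0 < R → ∀ (A : ℝ), 0 ≤ A → ∀ g : ℤ → ℝ,
      (∀ k : ℤ, |g k| ≤ A * min ((|(k : ℝ)| / R) ^ β) 1) →
      Summable (fun k => g k * Ks s k) ∧
        |∑' k, g k * Ks s k| ≤ C * A * R ^ (-(2 * s)) := by
  obtain ⟨B, hB0, hB⟩ := exists_abs_Ks_le hs0 hs1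
  have hσ0 : 0 < 2 * s := by linarith
  have hβ0 : 0 < β := by linarith
  have ha0 : 0 < β - 2 * s := by linarith
  refine ⟨2 * B * (1 / (β - 2 * s) + 2 ^ (1 + 2 * s) / (2 * s)), by positivity, ?_⟩
  intro R hR A hA g hg
  have hnn := truncWeight_nonneg (β := β) (σ := 2 * s) hR
  have hle := sum_truncWeight_le hβ1 hσ0 hsβ hR
  have hsum := (summable_of_sum_range_le hnn hle).hasSum
  have hT := Real.tsum_le_of_sum_range_le hnn hle
  set T := ∑' n, truncWeight β (2 * s) R n
  have hZ : HasSum (fun k : ℤ => truncWeight β (2 * s) R k.natAbs) (T + T) := by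
    have := HasSum.of_nat_of_neg (f := fun k : ℤ => truncWeight β (2 * s) R k.natAbs)
      (g := T) (g' := T) (by simpa using hsum) (by simpa using hsum)
    simpa [truncWeight_zero hβ0] using this
  have hZ' := hZ.mul_left (A * B)
  have hb : ∀ k : ℤ, ‖g k * Ks s k‖ ≤ A * B * truncWeight β (2 * s) R k.natAbs := by
    intro k
    have hk : (k.natAbs : ℝ) = |(k : ℝ)| := by
      rw [Nat.cast_natAbs, Int.cast_abs]
    rw [Real.norm_eq_abs, abs_mul]
    calc |g k| * |Ks s k|
        ≤ (A * min ((|(k : ℝ)| / R) ^ β) 1) * (B * (k.natAbs : ℝ) ^ (-1 - 2 * s)) :=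
          mul_le_mul (hg k) (hB k) (abs_nonneg _) ((abs_nonneg _).trans (hg k))
      _ = _ := by
          rw [truncWeight, hk]
          ring
  refine ⟨Summable.of_norm_bounded hZ'.summable hb, ?_⟩
  refine (tsum_of_norm_bounded hZ' hb).trans ?_
  calc A * B * (T + T) = 2 * A * B * T := by ring
    _ ≤ 2 * A * B * ((1 / (β - 2 * s) + 2 ^ (1 + 2 * s) / (2 * s)) * R ^ (-(2 * s))) := by gcongr
    _ = _ := by ring

theorem fracDiscLap_eq_tsum_shift (s h : ℝ) (u : ℤ → ℝ) (j : ℤ) :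
    fracDiscLap s h u j = h ^ (-(2 * s)) * ∑' k : ℤ, (u j - u (j - k)) * Ks s k := by
  rw [fracDiscLap, ← (Equiv.subLeft j).tsum_eq]
  simp

/-- Hölder regularity of the fractional discrete Laplacian: `C_h^{0,β} → C_h^{0,β−2s}`
when `2s < β`.  Here `M` bounds `sup_j |u_j|` and `L` bounds the discrete Hölder
seminorm `[u]_{C_h^{0,β}}`. -/
theorem fracDiscLap_Holder_C0 (β s : ℝ) (hβ0 : 0 < β) (hβ1 : β ≤ 1)
    (hs0 : 0 < s) (hs1 : s < 1) (hsβ : 2 * s < β) :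
    ∃ C : ℝ, 0 < C ∧ ∀ (h : ℝ), 0 < h → ∀ (u : ℤ → ℝ) (M L : ℝ),
      (∀ j : ℤ, |u j| ≤ M) →
      (∀ j m : ℤ, |u j - u m| ≤ L * (h * |(j : ℝ) - (m : ℝ)|) ^ β) →
      (∀ j : ℤ, |fracDiscLap s h u j| ≤ C * (M + L)) ∧
      (∀ j m : ℤ, |fracDiscLap s h u j - fracDiscLap s h u m| ≤
        C * (M + L) * (h * |(j : ℝ) - (m : ℝ)|) ^ (β - 2 * s)) := by
  obtain ⟨C, hC0, hC⟩ := exists_tsum_mul_Ks_le hβ1 hs0 hs1 hsβ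
  refine ⟨2 * C, by positivity, fun h hh u M L hM hL => ?_⟩
  have hM0 : 0 ≤ M := (abs_nonneg _).trans (hM 0)
  have hL0 : 0 ≤ L := by
    have h1 := (abs_nonneg _).trans (hL 1 0)
    refine nonneg_of_mul_nonneg_left h1 (Real.rpow_pos_of_pos ?_ β)
    simpa using hh
  have hincr : ∀ j k : ℤ, |u j - u (j - k)| ≤ L * (h * |(k : ℝ)|) ^ β := by
    intro j k
    simpa using hL j (j - k)
  have hsup : ∀ j k : ℤ, |u j - u (j - k)| ≤ 2 * (M + L) * min ((|(k : ℝ)| / h⁻¹) ^ β) 1 := by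
    intro j k
    rw [div_inv_eq_mul, mul_comm _ h, mul_min_of_nonneg _ _ (by positivity)]
    refine le_min ((hincr j k).trans ?_) ?_
    · gcongr
      linarith
    · have h1 := abs_sub (u j) (u (j - k))
      linarith [hM j, hM (j - k)]
  have hinv : (0 : ℝ) < h⁻¹ := inv_pos.2 hh
  refine ⟨fun j => ?_, fun j m => ?_⟩
  · have h1 := (hC h⁻¹ hinv (2 * (M + L)) (by positivity) _ (hsup j)).2
    rw [fracDiscLap_eq_tsum_shift, abs_mul, abs_of_nonneg (Real.rpow_nonneg hh.le _)]
    calc h ^ (-(2 * s)) * |∑' k, (u j - u (j - k)) * Ks s k|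
        ≤ h ^ (-(2 * s)) * (C * (2 * (M + L)) * h⁻¹ ^ (-(2 * s))) := by gcongr
      _ = (h * h⁻¹) ^ (-(2 * s)) * (2 * C * (M + L)) := by
        rw [Real.mul_rpow hh.le hinv.le]
        ring
      _ = 2 * C * (M + L) := by
        rw [mul_inv_cancel₀ hh.ne', Real.one_rpow, one_mul]
  · rcases eq_or_ne j m with rfl | hjm
    · rw [sub_self, abs_zero]
      positivity
    set p : ℝ := |(j : ℝ) - (m : ℝ)| with hp
    have hp0 : 0 < p := abs_pos.2 (sub_ne_zero.2 (Int.cast_injective.ne hjm))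
    have hbound : ∀ k : ℤ, |(u j - u (j - k)) - (u m - u (m - k))|
        ≤ 2 * L * (h * p) ^ β * min ((|(k : ℝ)| / p) ^ β) 1 := by
      intro k
      rw [mul_min_of_nonneg _ _ (by positivity)]
      refine le_min ?_ ?_
      · have e : (h * p) ^ β * (|(k : ℝ)| / p) ^ β = (h * |(k : ℝ)|) ^ β := by
          rw [← Real.mul_rpow (by positivity) (by positivity)]
          congr 1
          field_simp
        rw [mul_assoc, e]
        have h1 := abs_sub (u j - u (j - k)) (u m - u (m - k))
        linarith [hincr j k, hincr m k]
      · have e : (u j - u (j - k)) - (u m - u (m - k)) = (u j - u m) - (u (j - k) - u (m - k)) := by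
          ring
        have h1 := abs_sub (u j - u m) (u (j - k) - u (m - k))
        have h2 := hL j m
        have h3 := hL (j - k) (m - k)
        push_cast at h3
        rw [sub_sub_sub_cancel_right] at h3
        rw [e]
        linarith
    have hsj := (hC h⁻¹ hinv (2 * (M + L)) (by positivity) _ (hsup j)).1
    have hsm := (hC h⁻¹ hinv (2 * (M + L)) (by positivity) _ (hsup m)).1
    have h1 := (hC p hp0 (2 * L * (h * p) ^ β) (by positivity) _ hbound).2
    simp only [sub_mul _ _ (Ks s _)] at h1 hsj hsm
    rw [hsj.tsum_sub hsm] at h1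
    simp only [← sub_mul] at h1
    rw [fracDiscLap_eq_tsum_shift, fracDiscLap_eq_tsum_shift, ← mul_sub, abs_mul,
      abs_of_nonneg (Real.rpow_nonneg hh.le _)]
    have hhp : 0 < h * p := mul_pos hh hp0
    calc h ^ (-(2 * s)) * |∑' k, (u j - u (j - k)) * Ks s k - ∑' k, (u m - u (m - k)) * Ks s k|
        ≤ h ^ (-(2 * s)) * (C * (2 * L * (h * p) ^ β) * p ^ (-(2 * s))) := by gcongr
      _ = 2 * C * L * ((h * p) ^ β * (h * p) ^ (-(2 * s))) := by
        rw [Real.mul_rpow hh.le hp0.le (z := -(2 * s))]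
        ring
      _ = 2 * C * L * (h * p) ^ (β - 2 * s) := by
        rw [← Real.rpow_add hhp, sub_eq_add_neg]
      _ ≤ 2 * C * (M + L) * (h * p) ^ (β - 2 * s) := by
        gcongr
        linarith
end

section
/- Let 0<s<1 and set c_s = 4^s Γ(1/2+s)/(√π |Γ(−s)|). There exists a constant C_s>0 depending only on s such that for every h>0, every j ∈ ℤ, and every m ∈ ℤ with m≠0, one has | c_s ∫_{h(j+m)−h/2}^{h(j+m)+h/2} |hj − y|^{−1−2s} dy − K_s(m)/h^{2s} | ≤ C_s / (h^{2s} |m|^{2+2s}). -/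
open Real MeasureTheory

/-- The normalizing constant `c_s = 4^s Γ(1/2+s)/(√π |Γ(−s)|)`. -/
noncomputable def cs (s : ℝ) : ℝ :=
  4 ^ s * Real.Gamma (1 / 2 + s) / (Real.sqrt Real.pi * |Real.Gamma (-s)|)

theorem Gamma_add_le_rpow_mul_Gamma {x a : ℝ} (hx : 0 < x) (ha0 : 0 < a) (ha1 : a < 1) :
    Real.Gamma (x + a) ≤ x ^ a * Real.Gamma x := by
  have h := Real.Gamma_mul_add_mul_le_rpow_Gamma_mul_rpow_Gamma (s := x) (t := x + 1)
    (a := 1 - a) (b := a) hx (by linarith) (by linarith) ha0 (by ring)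
  have hG := Real.Gamma_pos_of_pos hx
  rw [Real.Gamma_add_one hx.ne', Real.mul_rpow hx.le hG.le] at h
  have e1 : (1 - a) * x + a * (x + 1) = x + a := by ring
  have e2 : Real.Gamma x ^ (1 - a) * (x ^ a * Real.Gamma x ^ a) = x ^ a * Real.Gamma x := by
    have : Real.Gamma x ^ (1 - a) * Real.Gamma x ^ a = Real.Gamma x := by
      rw [← Real.rpow_add hG]; simp
    linear_combination x ^ a * this
  rwa [e1, e2] at h

theorem rpow_mul_Gamma_le_Gamma_add {x a : ℝ} (hx : 0 < x) (ha0 : 0 < a) (ha1 : a < 1) :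
    x ^ a * Real.Gamma x * x ≤ (x + 1) * Real.Gamma (x + a) := by
  have hG := Real.Gamma_pos_of_pos hx
  have hGa : 0 < Real.Gamma (x + a) := Real.Gamma_pos_of_pos (by linarith)
  have h := Gamma_add_le_rpow_mul_Gamma (x := x + a) (a := 1 - a) (by linarith)
    (by linarith) (by linarith)
  rw [show x + a + (1 - a) = x + 1 by ring, Real.Gamma_add_one hx.ne'] at h
  have hmono : x ^ a ≤ (x + 1) ^ a := Real.rpow_le_rpow hx.le (by linarith) ha0.le
  calc x ^ a * Real.Gamma x * x = x ^ a * (x * Real.Gamma x) := by ring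
    _ ≤ (x + 1) ^ a * ((x + 1) ^ (1 - a) * Real.Gamma (x + a)) := by
        exact mul_le_mul hmono (h.trans (by gcongr)) (by positivity) (by positivity)
    _ = (x + 1) * Real.Gamma (x + a) := by
        rw [← mul_assoc, ← Real.rpow_add (by linarith)]; simp

theorem abs_mul_sq_div_sub_le {s x r : ℝ} (hs0 : 0 < s) (hs1 : s < 1) (hx : 1 ≤ x)
    (le_r : x ^ 2 / (x + 1) ≤ r) (r_le : r ≤ x + 1) :
    |r * x ^ 2 / (x ^ 2 - s ^ 2) - x| ≤ 2 / (1 - s ^ 2) := by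
  have hs2 : 0 < 1 - s ^ 2 := by nlinarith
  have hE : 0 < x ^ 2 - s ^ 2 := by nlinarith
  have hr0 : 0 < r := lt_of_lt_of_le (by positivity) le_r
  rw [abs_le]
  constructor
  · have h1 : r ≤ r * x ^ 2 / (x ^ 2 - s ^ 2) := by
      rw [le_div_iff₀ hE]
      gcongr
      nlinarith
    have h2 : x - 1 ≤ x ^ 2 / (x + 1) := by
      rw [le_div_iff₀ (by linarith)]
      nlinarith
    have h3 : 1 ≤ 2 / (1 - s ^ 2) := by
      rw [le_div_iff₀ hs2]
      nlinarith
    linarith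
  · have h1 : r * x ^ 2 / (x ^ 2 - s ^ 2) ≤ (x + 1) * x ^ 2 / (x ^ 2 - s ^ 2) := by gcongr
    have h2 : (x + 1) * x ^ 2 / (x ^ 2 - s ^ 2) - x = (x ^ 2 + s ^ 2 * x) / (x ^ 2 - s ^ 2) := by
      field_simp
      ring
    have h3 : (x ^ 2 + s ^ 2 * x) / (x ^ 2 - s ^ 2) ≤ 2 / (1 - s ^ 2) := by
      rw [div_le_div_iff₀ hE hs2]
      have hx2 : x ≤ x ^ 2 := by nlinarith
      have hx3 : 1 ≤ x ^ 2 := by nlinarith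
      have h5 : x ^ 2 + s ^ 2 * x ≤ 2 * x ^ 2 := by nlinarith [sq_nonneg s]
      have h6 : x ^ 2 * (1 - s ^ 2) ≤ x ^ 2 - s ^ 2 := by nlinarith [sq_nonneg s]
      calc (x ^ 2 + s ^ 2 * x) * (1 - s ^ 2) ≤ 2 * x ^ 2 * (1 - s ^ 2) := by gcongr
        _ ≤ 2 * (x ^ 2 - s ^ 2) := by linarith
    linarith

theorem abs_Gamma_div_Gamma_sub_rpow_le {s x : ℝ} (hs0 : 0 < s) (hs1 : s < 1) (hx : 1 ≤ x) :
    |Real.Gamma (x - s) / Real.Gamma (x + 1 + s) - x ^ (-(1 + 2 * s))| ≤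
      2 / (1 - s ^ 2) * x ^ (-(2 + 2 * s)) := by
  have hx0 : 0 < x := by linarith
  have hG := Real.Gamma_pos_of_pos hx0
  have hB : 0 < Real.Gamma (x + s) := Real.Gamma_pos_of_pos (by linarith)
  have hxs : 0 < x - s := by linarith
  have hxs' : 0 < x + s := by linarith
  have a1 := Gamma_add_le_rpow_mul_Gamma (a := 1 - s) hx0 (by linarith) (by linarith)
  have a2 := rpow_mul_Gamma_le_Gamma_add (a := 1 - s) hx0 (by linarith) (by linarith)
  have b1 := Gamma_add_le_rpow_mul_Gamma hx0 hs0 hs1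
  have b2 := rpow_mul_Gamma_le_Gamma_add hx0 hs0 hs1
  have eA : Real.Gamma (x + (1 - s)) = (x - s) * Real.Gamma (x - s) := by
    rw [← Real.Gamma_add_one hxs.ne']; congr 1; ring
  have eB : Real.Gamma (x + 1 + s) = (x + s) * Real.Gamma (x + s) := by
    rw [← Real.Gamma_add_one hxs'.ne']; congr 1; ring
  set A := Real.Gamma (x + (1 - s))
  set B := Real.Gamma (x + s)
  have eR : Real.Gamma (x - s) / Real.Gamma (x + 1 + s) = A / ((x - s) * (x + s) * B) := by
    rw [eB, eA]; field_simp
  set q := x ^ s with hq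
  have hq0 : 0 < q := Real.rpow_pos_of_pos hx0 _
  have e1 : x ^ (1 - s) = x / q := by rw [Real.rpow_sub hx0, Real.rpow_one]
  have e2s : x ^ (2 * s) = q ^ 2 := by
    rw [two_mul, Real.rpow_add hx0]; ring
  have e2 : x ^ (-(1 + 2 * s)) = 1 / (x * q ^ 2) := by
    rw [Real.rpow_neg hx0.le, Real.rpow_add hx0, Real.rpow_one, e2s, one_div]
  have e3 : x ^ (-(2 + 2 * s)) = 1 / (x ^ 2 * q ^ 2) := by
    rw [Real.rpow_neg hx0.le, Real.rpow_add hx0, e2s, one_div]; norm_num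
  set G := Real.Gamma x
  rw [e1] at a1 a2
  have a1' : A * q ≤ x * G := by
    calc A * q ≤ x / q * G * q := by gcongr
      _ = x * G := by field_simp
  have a2' : x ^ 2 * G ≤ (x + 1) * (A * q) := by
    calc x ^ 2 * G = (x / q * G * x) * q := by field_simp
      _ ≤ ((x + 1) * A) * q := by gcongr
      _ = _ := by ring
  have r_le : A * q ^ 2 / B ≤ x + 1 := by
    rw [div_le_iff₀ hB]
    calc A * q ^ 2 = A * q * q := by ring
      _ ≤ x * G * q := by gcongr
      _ = q * G * x := by ring
      _ ≤ (x + 1) * B := b2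
  have le_r : x ^ 2 / (x + 1) ≤ A * q ^ 2 / B := by
    rw [div_le_div_iff₀ (by linarith) hB]
    calc x ^ 2 * B ≤ x ^ 2 * (q * G) := by gcongr
      _ = x ^ 2 * G * q := by ring
      _ ≤ (x + 1) * (A * q) * q := by gcongr
      _ = A * q ^ 2 * (x + 1) := by ring
  set r := A * q ^ 2 / B with hr
  have eD : A / ((x - s) * (x + s) * B) - 1 / (x * q ^ 2) =
      (r * x ^ 2 / (x ^ 2 - s ^ 2) - x) * (1 / (x ^ 2 * q ^ 2)) := by
    rw [hr, show x ^ 2 - s ^ 2 = (x - s) * (x + s) by ring]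
    have := hxs.ne'
    have := hxs'.ne'
    clear_value A B q G
    field_simp
  have key := abs_mul_sq_div_sub_le hs0 hs1 hx le_r r_le
  rw [eR, e2, e3, eD, abs_mul, abs_of_pos (show 0 < 1 / (x ^ 2 * q ^ 2) by positivity)]
  gcongr

theorem abs_rpow_neg_sub_one_le {p t : ℝ} (hp : 0 < p) (ht : 1 / 2 ≤ t) :
    |t ^ (-p) - 1| ≤ p * (1 / 2) ^ (-p - 1) * |t - 1| := by
  have h := (convex_Ici (1 / 2 : ℝ)).norm_image_sub_le_of_norm_hasDerivWithin_le
    (f := fun t : ℝ => t ^ (-p)) (f' := fun t => -p * t ^ (-p - 1))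
    (C := p * (1 / 2) ^ (-p - 1)) (x := 1) (y := t)
    (fun u hu => (Real.hasDerivAt_rpow_const (Or.inl (by
      have : (1 / 2 : ℝ) ≤ u := hu
      linarith))).hasDerivWithinAt)
    (fun u hu => by
      have hu' : (1 / 2 : ℝ) ≤ u := hu
      have hu0 : 0 < u := by linarith
      rw [Real.norm_eq_abs, abs_mul, abs_neg, abs_of_pos hp,
        abs_of_pos (Real.rpow_pos_of_pos hu0 _)]
      exact mul_le_mul_of_nonneg_left
        (Real.rpow_le_rpow_of_nonpos (by norm_num) hu' (by linarith)) hp.le)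
    (by norm_num : (1 : ℝ) ∈ Set.Ici (1 / 2 : ℝ)) ht
  simpa [Real.norm_eq_abs] using h

theorem abs_rpow_neg_sub_rpow_neg_le {p h a b : ℝ} (hp : 0 < p) (hb : h ≤ b) (hh : 0 < h)
    (hab : |a - b| ≤ h / 2) :
    |a ^ (-p) - b ^ (-p)| ≤ p * (1 / 2) ^ (-p - 1) * (h / b) * b ^ (-p) := by
  have hb0 : 0 < b := by linarith
  have ha : b / 2 ≤ a := by linarith [(abs_le.1 hab).1]
  have ht : 1 / 2 ≤ a / b := by rw [le_div_iff₀ hb0]; linarith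
  have key := abs_rpow_neg_sub_one_le hp ht
  have hbp : 0 < b ^ (-p) := Real.rpow_pos_of_pos hb0 _
  have e : a ^ (-p) = (a / b) ^ (-p) * b ^ (-p) := by
    rw [← Real.mul_rpow (by linarith) hb0.le, div_mul_cancel₀ _ hb0.ne']
  have e' : |a / b - 1| ≤ h / b := by
    rw [show a / b - 1 = (a - b) / b by field_simp, abs_div, abs_of_pos hb0]
    gcongr
    linarith
  rw [e, show (a / b) ^ (-p) * b ^ (-p) - b ^ (-p) = ((a / b) ^ (-p) - 1) * b ^ (-p) by ring,
    abs_mul, abs_of_pos hbp]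
  gcongr
  exact key.trans (by gcongr)

theorem abs_setIntegral_cell_sub_le {p h : ℝ} (hp : 0 < p) (hh : 0 < h) (j m : ℤ) (hm : m ≠ 0) :
    |(∫ y in Set.Ioo (h * ((j : ℝ) + (m : ℝ)) - h / 2) (h * ((j : ℝ) + (m : ℝ)) + h / 2),
        |h * (j : ℝ) - y| ^ (-p)) - h * (h * |(m : ℝ)|) ^ (-p)| ≤
      p * (1 / 2) ^ (-p - 1) * (h / (h * |(m : ℝ)|)) * (h * |(m : ℝ)|) ^ (-p) * h := by
  have hm1 : (1 : ℝ) ≤ |(m : ℝ)| := by exact_mod_cast Int.one_le_abs hm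
  set S := Set.Ioo (h * ((j : ℝ) + (m : ℝ)) - h / 2) (h * ((j : ℝ) + (m : ℝ)) + h / 2) with hS
  set b := h * |(m : ℝ)| with hb
  have hhb : h ≤ b := by nlinarith
  have hpt : ∀ y ∈ S, ‖|h * (j : ℝ) - y| ^ (-p) - b ^ (-p)‖ ≤
      p * (1 / 2) ^ (-p - 1) * (h / b) * b ^ (-p) := by
    intro y hy
    refine abs_rpow_neg_sub_rpow_neg_le hp hhb hh ?_
    have e : b = |h * (m : ℝ)| := by rw [abs_mul, abs_of_pos hh]
    rw [e, abs_sub_comm (h * (j : ℝ))]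
    refine (abs_abs_sub_abs_le _ _).trans ?_
    rw [abs_le]
    constructor <;> linarith [hy.1, hy.2]
  have hvol : volume S < ⊤ := by simp [hS]
  have hreal : volume.real S = h := by
    rw [hS, Real.volume_real_Ioo_of_le (by linarith)]; ring
  have hmeas : Measurable fun y : ℝ => |h * (j : ℝ) - y| ^ (-p) := by fun_prop
  have hintd : IntegrableOn (fun y => |h * (j : ℝ) - y| ^ (-p) - b ^ (-p)) S :=
    Measure.integrableOn_of_bounded hvol.ne (hmeas.sub_const _).aestronglyMeasurable
      ((ae_restrict_iff' measurableSet_Ioo).2 (Filter.Eventually.of_forall hpt))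
  have hconst : IntegrableOn (fun _ : ℝ => b ^ (-p)) S := integrableOn_const hvol.ne
  have hint : IntegrableOn (fun y => |h * (j : ℝ) - y| ^ (-p)) S := by
    exact (hintd.add hconst).congr_fun (fun y _ => sub_add_cancel _ _) measurableSet_Ioo
  have hle := norm_setIntegral_le_of_norm_le_const hvol hpt
  rw [integral_sub hint hconst, setIntegral_const, hreal, smul_eq_mul] at hle
  exact hle

theorem kernel_comparison (s : ℝ) (hs0 : 0 < s) (hs1 : s < 1) :
    ∃ C : ℝ, 0 < C ∧ ∀ (h : ℝ), 0 < h → ∀ j m : ℤ, m ≠ 0 →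
      |cs s * (∫ y in Set.Ioo (h * ((j : ℝ) + (m : ℝ)) - h / 2)
            (h * ((j : ℝ) + (m : ℝ)) + h / 2), |h * (j : ℝ) - y| ^ (-(1 + 2 * s))) -
          Ks s m / h ^ (2 * s)| ≤
        C / (h ^ (2 * s) * |(m : ℝ)| ^ (2 + 2 * s)) := by
  have hs2 : 0 < 1 - s ^ 2 := by nlinarith
  set L := (1 + 2 * s) * (1 / 2) ^ (-(1 + 2 * s) - 1) with hLdef
  have hL : 0 < L := by positivity
  have hc : 0 ≤ cs s := by
    have := Real.Gamma_pos_of_pos (show 0 < 1 / 2 + s by linarith)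
    unfold cs
    positivity
  refine ⟨(cs s + 1) * (L + 2 / (1 - s ^ 2)), by positivity, fun h hh j m hm => ?_⟩
  have hm1 : (1 : ℝ) ≤ |(m : ℝ)| := by exact_mod_cast Int.one_le_abs hm
  have hcell := abs_setIntegral_cell_sub_le (p := 1 + 2 * s) (by linarith) hh j m hm
  have hgam := abs_Gamma_div_Gamma_sub_rpow_le hs0 hs1 hm1
  have hK : Ks s m = cs s * (Real.Gamma (|(m : ℝ)| - s) / Real.Gamma (|(m : ℝ)| + 1 + s)) := by
    rw [Ks, if_neg hm, cs, div_mul_div_comm]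
  rw [hK]
  set x := |(m : ℝ)|
  have hx0 : 0 < x := by linarith
  set I := ∫ y in Set.Ioo (h * ((j : ℝ) + (m : ℝ)) - h / 2)
            (h * ((j : ℝ) + (m : ℝ)) + h / 2), |h * (j : ℝ) - y| ^ (-(1 + 2 * s))
  set R := Real.Gamma (x - s) / Real.Gamma (x + 1 + s)
  set H := h ^ (2 * s) with hH
  have hH0 : 0 < H := Real.rpow_pos_of_pos hh _
  have eh : (h * x) ^ (-(1 + 2 * s)) = x ^ (-(1 + 2 * s)) / (h * H) := by
    rw [Real.mul_rpow hh.le hx0.le, Real.rpow_neg hh.le, Real.rpow_add hh, Real.rpow_one,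
      ← hH]
    field_simp
  have ex : x ^ (-(1 + 2 * s)) = x * x ^ (-(2 + 2 * s)) := by
    rw [← Real.rpow_one_add' hx0.le (by linarith)]; congr 1; ring
  have ex' : x ^ (2 + 2 * s) = (x ^ (-(2 + 2 * s)))⁻¹ := by
    rw [Real.rpow_neg hx0.le, inv_inv]
  rw [eh] at hcell
  rw [ex']
  rw [ex] at hcell hgam
  set w := x ^ (-(2 + 2 * s))
  have hw : 0 < w := Real.rpow_pos_of_pos hx0 _
  have h1 : |I - x * w / H| ≤ L * w / H := by
    convert hcell using 1
    · congr 2; field_simp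
    · rw [← hLdef]
      field_simp
  have h2 : |x * w / H - R / H| ≤ 2 / (1 - s ^ 2) * w / H := by
    rw [← sub_div, abs_div, abs_of_pos hH0, abs_sub_comm]
    gcongr
  calc |cs s * I - cs s * R / H| = cs s * |I - R / H| := by
        rw [← abs_of_nonneg hc, ← abs_mul, abs_of_nonneg hc]; congr 1; ring
    _ ≤ (cs s + 1) * (L * w / H + 2 / (1 - s ^ 2) * w / H) := by
        gcongr
        · linarith
        · exact (abs_sub_le _ _ _).trans (add_le_add h1 h2)
    _ = _ := by field_simp
end

section
/- Let 0<s<1/2. There exists a constant C_s>0 depending only on s such that for every integer m ≥ 1, | Γ(m+s)/Γ(m+1−s) − 1/m^{1−2s} | ≤ C_s / m^{2−2s}. -/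
open Real

theorem Gamma_add_le_rpow_mul_Gamma_s14 {x t : ℝ} (hx : 0 < x) (ht0 : 0 < t) (ht1 : t < 1) :
    Gamma (x + t) ≤ x ^ t * Gamma x := by
  have h := Gamma_mul_add_mul_le_rpow_Gamma_mul_rpow_Gamma hx (by linarith : 0 < x + 1)
    (by linarith : 0 < 1 - t) ht0 (by ring)
  have hΓ := Gamma_pos_of_pos hx
  calc Gamma (x + t) = Gamma ((1 - t) * x + t * (x + 1)) := by ring_nf
    _ ≤ Gamma x ^ (1 - t) * Gamma (x + 1) ^ t := h
    _ = x ^ t * (Gamma x ^ (1 - t) * Gamma x ^ t) := by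
      rw [Gamma_add_one hx.ne', mul_rpow hx.le hΓ.le]; ring
    _ = x ^ t * Gamma x := by rw [← rpow_add hΓ, sub_add_cancel, rpow_one]

theorem Gamma_add_le_rpow_mul_Gamma_add_one_sub {x t : ℝ} (hx : 0 < x) (ht0 : 0 < t)
    (ht1 : t < 1) :
    Gamma (x + t) ≤ x ^ (2 * t - 1) * (1 + 1 / x) * Gamma (x + 1 - t) := by
  have hB : 0 < Gamma (x + 1 - t) := Gamma_pos_of_pos (by linarith)
  have h_shift : x * Gamma x ≤ (x + 1 - t) ^ t * Gamma (x + 1 - t) := by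
    have h := Gamma_add_le_rpow_mul_Gamma_s14 (by linarith : 0 < x + 1 - t) ht0 ht1
    rwa [sub_add_cancel, Gamma_add_one hx.ne'] at h
  have h_pow : (x + 1 - t) ^ t ≤ x ^ t * (1 + 1 / x) := by
    have h_one : 1 ≤ 1 + 1 / x := by have := one_div_pos.2 hx; linarith
    calc (x + 1 - t) ^ t ≤ (x * (1 + 1 / x)) ^ t := by
          apply rpow_le_rpow (by linarith) _ ht0.le
          field_simp
          linarith
      _ = x ^ t * (1 + 1 / x) ^ t := mul_rpow hx.le (by linarith)
      _ ≤ x ^ t * (1 + 1 / x) := by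
          gcongr
          simpa using rpow_le_rpow_of_exponent_le h_one ht1.le
  calc Gamma (x + t) ≤ x ^ t * Gamma x := Gamma_add_le_rpow_mul_Gamma_s14 hx ht0 ht1
    _ = x ^ t / x * (x * Gamma x) := by field_simp
    _ ≤ x ^ t / x * (x ^ t * (1 + 1 / x) * Gamma (x + 1 - t)) := by
      refine mul_le_mul_of_nonneg_left (h_shift.trans ?_) (by positivity)
      exact mul_le_mul_of_nonneg_right h_pow hB.le
    _ = x ^ (2 * t - 1) * (1 + 1 / x) * Gamma (x + 1 - t) := by
      rw [rpow_sub_one hx.ne', two_mul, rpow_add hx]; ring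

theorem gamma_ratio_integral_asymptotics (s : ℝ) (hs0 : 0 < s) (hs1 : s < 1 / 2) :
    ∃ C : ℝ, 0 < C ∧ ∀ m : ℕ, 1 ≤ m →
      |Real.Gamma ((m : ℝ) + s) / Real.Gamma ((m : ℝ) + 1 - s) - 1 / (m : ℝ) ^ (1 - 2 * s)| ≤
        C / (m : ℝ) ^ (2 - 2 * s) := by
  refine ⟨1, one_pos, fun m hm => ?_⟩
  have hx : (0 : ℝ) < m := by exact_mod_cast hm
  generalize (m : ℝ) = x at hx
  have hA : 0 < Gamma (x + s) := Gamma_pos_of_pos (by linarith)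
  have hB : 0 < Gamma (x + 1 - s) := Gamma_pos_of_pos (by linarith)
  have h_upper := Gamma_add_le_rpow_mul_Gamma_add_one_sub hx hs0 (by linarith)
  have h_lower := Gamma_add_le_rpow_mul_Gamma_add_one_sub hx
    (by linarith : 0 < 1 - s) (by linarith)
  rw [show x + (1 - s) = x + 1 - s by ring, show x + 1 - (1 - s) = x + s by ring,
    show 2 * (1 - s) - 1 = 1 - 2 * s by ring] at h_lower
  rw [show 2 * s - 1 = -(1 - 2 * s) by ring, rpow_neg hx.le] at h_upper
  rw [show 2 - 2 * s = (1 - 2 * s) + 1 by ring, rpow_add_one hx.ne']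
  have hP : 0 < x ^ (1 - 2 * s) := rpow_pos_of_pos hx _
  generalize x ^ (1 - 2 * s) = P at *
  generalize Gamma (x + s) = A at *
  generalize Gamma (x + 1 - s) = B at *
  have h_upper' : A / B ≤ P⁻¹ * (1 + 1 / x) := (div_le_iff₀ hB).2 h_upper
  have h_lower' : 1 ≤ P * (1 + 1 / x) * (A / B) := by
    rw [← mul_div_assoc]
    exact (one_le_div hB).2 h_lower
  have h_recip : P⁻¹ * (1 - 1 / x) ≤ A / B := by
    have hr : 0 < A / B := div_pos hA hB
    rw [inv_mul_le_iff₀ hP]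
    have hy : 0 < 1 / x := one_div_pos.2 hx
    generalize 1 / x = y at *
    have hq : 0 < P * (A / B) := mul_pos hP hr
    generalize A / B = r at *
    nlinarith [sq_nonneg y]
  have h_err : 1 / (P * x) = P⁻¹ * (1 / x) := by field_simp
  rw [h_err, one_div P, abs_le]
  constructor <;> linarith
end
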